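/- arXiv:2406.19819 — 4 statements merged into one kernel-verified Lean document; each statement's English description precedes it below -/
import Mathlib

section
/- Let G be a finite simple graph and K ⊆ V(G), and let Ĝ be the graph obtained from G by subdividing every edge and attaching a triangle to each terminal. Then tw_Δfree(Ĝ) ≤ max{tw_K(G,K), 1}; more precisely, given any tree K-free-decomposition of G of width w, there exists a tree Δ-free-decomposition of Ĝ of width at most max{w, 1}. -/
/-- The raw data of a rooted tree decomposition of a graph on vertex type `W`:
a finite rooted tree `𝕋`, bags `χ : V(𝕋) → 2^W`, and a set `L ⊆ W` of vertices
that live only in leaf bags and do not count towards the width. -/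
structure PreDecomp (W : Type) where
  ι : Type
  finite_ι : Finite ι
  tree : SimpleGraph ι
  isTree : tree.IsTree
  root : ι
  bag : ι → Set W
  L : Set W

/-- A node of the rooted tree is a leaf if it has no children, i.e. it has at most one
neighbour (its parent), and none at all if it is the root. -/
def PreDecomp.IsLeaf {W : Type} (D : PreDecomp W) (x : D.ι) : Prop :=
  (D.tree.neighborSet x).Subsingleton ∧ (x = D.root → D.tree.neighborSet x = ∅)

/-- Conditions (K.A)–(K.C) (equivalently (Δ.A)–(Δ.C)): the bags containing each vertex
form a non-empty connected subtree; both endpoints of each edge share a bag; every vertex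
of `L` occurs in a unique bag, which is a leaf bag. -/
def IsTreeDecomp {W : Type} (H : SimpleGraph W) (D : PreDecomp W) : Prop :=
  (∀ v : W, (D.tree.induce {x : D.ι | v ∈ D.bag x}).Connected) ∧
  (∀ u v : W, H.Adj u v → ∃ x : D.ι, u ∈ D.bag x ∧ v ∈ D.bag x) ∧
  (∀ v ∈ D.L, ∃ x : D.ι, v ∈ D.bag x ∧ (∀ y : D.ι, v ∈ D.bag y → y = x) ∧ D.IsLeaf x)

/-- Condition (K.D): no bag contains a vertex of `L ∩ K`. -/
def KFreeCond {W : Type} (K : Set W) (D : PreDecomp W) : Prop :=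
  ∀ x : D.ι, D.bag x ∩ D.L ∩ K = ∅

/-- Condition (Δ.D): for each node `x`, the induced subgraph `H[χ(x) ∩ L]` is
triangle-free. -/
def DeltaFreeCond {W : Type} (H : SimpleGraph W) (D : PreDecomp W) : Prop :=
  ∀ x : D.ι, ¬ ∃ a b c : W, a ∈ D.bag x ∩ D.L ∧ b ∈ D.bag x ∩ D.L ∧ c ∈ D.bag x ∩ D.L ∧
    H.Adj a b ∧ H.Adj b c ∧ H.Adj a c

/-- The decomposition has width at most `w`, i.e. `max{0, max_x |χ(x)∖L| − 1} ≤ w`. -/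
def WidthLE {W : Type} (D : PreDecomp W) (w : ℕ) : Prop :=
  ∀ x : D.ι, (D.bag x \ D.L).ncard ≤ w + 1

/-- The asymmetric adjacency seed for `Ĝ`: the subdivision vertex `x_e` of an edge `e` is
joined to the endpoints of `e`, and each terminal `k` gets two new vertices
`k' = (k,false)` and `k'' = (k,true)` forming a triangle with it. -/
def hatRel {V : Type} (G : SimpleGraph V) :
    (V ⊕ Sym2 V ⊕ V × Bool) → (V ⊕ Sym2 V ⊕ V × Bool) → Prop
  | Sum.inl u, Sum.inr (Sum.inl e) => u ∈ e
  | Sum.inl u, Sum.inr (Sum.inr (k, _)) => u = k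
  | Sum.inr (Sum.inr (k₁, b₁)), Sum.inr (Sum.inr (k₂, b₂)) => k₁ = k₂ ∧ b₁ ≠ b₂
  | _, _ => False

/-- The vertex set of `Ĝ`: `V(G)`, one vertex `x_e` per edge `e ∈ E(G)`, and two vertices
`k', k''` per terminal `k ∈ K`. -/
def hatVerts {V : Type} (G : SimpleGraph V) (K : Finset V) : Set (V ⊕ Sym2 V ⊕ V × Bool) :=
  {x | match x with
    | Sum.inl _ => True
    | Sum.inr (Sum.inl e) => e ∈ G.edgeSet
    | Sum.inr (Sum.inr (k, _)) => k ∈ K}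

/-- The graph `Ĝ`, obtained from `G` by subdividing every edge and attaching a triangle to
each terminal. -/
def GHat {V : Type} (G : SimpleGraph V) (K : Finset V) : SimpleGraph (hatVerts G K) :=
  SimpleGraph.fromRel (fun a b => hatRel G a.val b.val)

theorem SimpleGraph.Reachable.of_forall_adj {α β : Type*} {G : SimpleGraph α}
    {H : SimpleGraph β} (f : α → β) (h : ∀ a b, G.Adj a b → H.Reachable (f a) (f b))
    {a b : α} (hab : G.Reachable a b) : H.Reachable (f a) (f b) := by
  obtain ⟨p⟩ := hab
  induction p with
  | nil => rfl
  | cons hadj _ ih => exact (h _ _ hadj).trans ih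

theorem SimpleGraph.induce_connected_of_forall_mem_iff {α : Type*} {G : SimpleGraph α}
    {s : Set α} {x : α} (h : ∀ y, y ∈ s ↔ y = x) : (G.induce s).Connected := by
  have : Subsingleton s :=
    ⟨fun a b ↦ Subtype.ext (((h a).1 a.2).trans ((h b).1 b.2).symm)⟩
  have : Nonempty s := ⟨⟨x, (h x).2 rfl⟩⟩
  exact SimpleGraph.Connected.of_subsingleton

/-- The graph obtained from `T` by attaching a pendant vertex `(x, true)` to each vertex
`x = (x, false)`. -/
def pendantGraph {ι : Type} (T : SimpleGraph ι) : SimpleGraph (ι × Bool) where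
  Adj a b := (a.2 = false ∧ b.2 = false ∧ T.Adj a.1 b.1) ∨ (a.1 = b.1 ∧ a.2 ≠ b.2)
  symm := ⟨by
    rintro a b (⟨h₁, h₂, h₃⟩ | ⟨h₁, h₂⟩)
    · exact Or.inl ⟨h₂, h₁, h₃.symm⟩
    · exact Or.inr ⟨h₁.symm, h₂.symm⟩⟩
  loopless := ⟨by rintro a (⟨_, _, h⟩ | ⟨_, h⟩) <;> simp at h⟩

theorem pendantGraph_adj_true {ι : Type} {T : SimpleGraph ι} {x : ι} {b : ι × Bool} :
    (pendantGraph T).Adj (x, true) b ↔ b = (x, false) := by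
  obtain ⟨y, b⟩ := b
  cases b <;> simp [pendantGraph, eq_comm (a := x)]

theorem pendantGraph_induce_connected {ι : Type} {T : SimpleGraph ι} {s : Set ι}
    (h : (T.induce s).Connected) :
    ((pendantGraph T).induce {a | a.1 ∈ s}).Connected := by
  have key : ∀ a : {a : ι × Bool | a.1 ∈ s}, ((pendantGraph T).induce {a | a.1 ∈ s}).Reachable
      ⟨(a.1.1, false), a.2⟩ a := by
    rintro ⟨⟨x, b⟩, hx⟩
    cases b
    · rfl
    · exact SimpleGraph.Adj.reachable (Or.inr ⟨rfl, by simp⟩)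
  have := h.nonempty
  refine (SimpleGraph.connected_iff _).2 ⟨fun a b ↦ ((key a).symm.trans ?_).trans (key b),
    ⟨⟨(Classical.arbitrary s, false), (Classical.arbitrary s).2⟩⟩⟩
  exact SimpleGraph.Reachable.of_forall_adj (G := T.induce s)
    (f := fun x : s ↦ (⟨(x.1, false), x.2⟩ : {a : ι × Bool | a.1 ∈ s}))
    (fun x y hxy ↦ SimpleGraph.Adj.reachable (Or.inl ⟨rfl, rfl, hxy⟩))
    (h.preconnected ⟨a.1.1, a.2⟩ ⟨b.1.1, b.2⟩)

theorem pendantGraph_connected {ι : Type} {T : SimpleGraph ι} (h : T.Connected) :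
    (pendantGraph T).Connected := by
  have h' : (T.induce Set.univ).Connected :=
    (SimpleGraph.induceUnivIso T).connected_iff.2 h
  exact (SimpleGraph.induceUnivIso _).connected_iff.1 (pendantGraph_induce_connected h')

theorem pendantGraph_isAcyclic {ι : Type} {T : SimpleGraph ι} (h : T.IsAcyclic) :
    (pendantGraph T).IsAcyclic := by
  rw [SimpleGraph.isAcyclic_iff_forall_adj_isBridge] at h ⊢
  have pendant : ∀ x : ι, (pendantGraph T).IsBridge s((x, true), (x, false)) := by
    intro x
    rw [SimpleGraph.isBridge_iff]
    rintro ⟨p⟩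
    cases p with
    | cons hadj _ =>
      rw [SimpleGraph.deleteEdges_adj, pendantGraph_adj_true] at hadj
      obtain ⟨rfl, hne⟩ := hadj
      exact hne rfl
  rintro ⟨x, b⟩ ⟨y, c⟩ hadj
  rcases id hadj with ⟨hb, hc, hxy⟩ | ⟨hxy, hbc⟩
  · obtain rfl : b = false := hb
    obtain rfl : c = false := hc
    have := h hxy
    rw [SimpleGraph.isBridge_iff] at this ⊢
    intro hr
    refine this (hr.of_forall_adj Prod.fst ?_)
    rintro ⟨u, i⟩ ⟨v, j⟩ huv
    rw [SimpleGraph.deleteEdges_adj] at huv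
    rcases huv with ⟨⟨hi, hj, huv⟩ | ⟨huv, -⟩, hne⟩
    · obtain rfl : i = false := hi
      obtain rfl : j = false := hj
      refine SimpleGraph.Adj.reachable ?_
      rw [SimpleGraph.deleteEdges_adj]
      refine ⟨huv, fun he ↦ hne ?_⟩
      simpa using he
    · obtain rfl : u = v := huv
      rfl
  · obtain rfl : x = y := hxy
    cases b <;> cases c
    · exact absurd rfl hbc
    · rw [Sym2.eq_swap]; exact pendant x
    · exact pendant x
    · exact absurd rfl hbc

/-- The decomposition of `Ĝ` obtained by attaching a copy of each node of `D` as a pendant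
leaf: the vertices of `L` are moved to these leaves, the subdivision vertex of `e` is put in
the leaf at `f e`, and the two new vertices at a terminal `k` in the leaf at `g k`. -/
def hatDecomp {V : Type} (G : SimpleGraph V) (K : Finset V) (D : PreDecomp V)
    (f : Sym2 V → D.ι) (g : V → D.ι) : PreDecomp (hatVerts G K) where
  ι := D.ι × Bool
  finite_ι := have := D.finite_ι; inferInstance
  tree := pendantGraph D.tree
  isTree := ⟨pendantGraph_connected D.isTree.1, pendantGraph_isAcyclic D.isTree.2⟩
  root := (D.root, false)
  bag x := {z | match z.val with
    | Sum.inl v => v ∈ D.bag x.1 ∧ (v ∈ D.L → x.2 = true)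
    | Sum.inr (Sum.inl e) => x = (f e, true)
    | Sum.inr (Sum.inr (k, _)) => x = (g k, true)}
  L := {z | match z.val with
    | Sum.inl v => v ∈ D.L
    | Sum.inr _ => True}

section hatDecomp

variable {V : Type} {G : SimpleGraph V} {K : Finset V} {D : PreDecomp V}
  {f : Sym2 V → D.ι} {g : V → D.ι}

theorem hatDecomp_isLeaf (x : D.ι) : (hatDecomp G K D f g).IsLeaf (x, true) := by
  refine ⟨fun a ha b hb ↦ ?_, fun h ↦ ?_⟩
  · exact (pendantGraph_adj_true.1 ha).trans (pendantGraph_adj_true.1 hb).symm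
  · exact absurd (congrArg Prod.snd h) (by simp [hatDecomp])

theorem hatDecomp_unique (hL : ∀ v ∈ D.L, ∀ x y, v ∈ D.bag x → v ∈ D.bag y → x = y)
    (hg : ∀ v, v ∈ D.bag (g v)) {z : hatVerts G K} (hz : z ∈ (hatDecomp G K D f g).L) :
    ∃ x : D.ι, ∀ y, z ∈ (hatDecomp G K D f g).bag y ↔ y = (x, true) := by
  obtain ⟨v | e | ⟨k, b⟩, hv⟩ := z
  · refine ⟨g v, fun y ↦ ⟨fun hy ↦ ?_, ?_⟩⟩
    · exact Prod.ext (hL v hz _ _ hy.1 (hg v)) (hy.2 hz)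
    · rintro rfl
      exact ⟨hg v, fun _ ↦ rfl⟩
  · exact ⟨f e, fun _ ↦ Iff.rfl⟩
  · exact ⟨g k, fun _ ↦ Iff.rfl⟩

theorem hatDecomp_exists_bag_of_hatRel (hf : ∀ e, e ∈ G.edgeSet → ∀ u ∈ e, u ∈ D.bag (f e))
    (hg : ∀ v, v ∈ D.bag (g v)) {a b : hatVerts G K} (hab : hatRel G a.val b.val) :
    ∃ x, a ∈ (hatDecomp G K D f g).bag x ∧ b ∈ (hatDecomp G K D f g).bag x := by
  obtain ⟨u | e | ⟨k, i⟩, ha⟩ := a <;> obtain ⟨v | e' | ⟨l, j⟩, hb⟩ := b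
  case inl.inr.inl => exact ⟨(f e', true), ⟨hf e' hb u hab, fun _ ↦ rfl⟩, rfl⟩
  case inl.inr.inr =>
    obtain rfl : u = l := hab
    exact ⟨(g u, true), ⟨hg u, fun _ ↦ rfl⟩, rfl⟩
  case inr.inr.inr.inr =>
    obtain rfl : k = l := hab.1
    exact ⟨(g k, true), rfl, rfl⟩
  all_goals exact hab.elim

theorem hatDecomp_isTreeDecomp
    (hconn : ∀ v, (D.tree.induce {x | v ∈ D.bag x}).Connected)
    (hL : ∀ v ∈ D.L, ∀ x y, v ∈ D.bag x → v ∈ D.bag y → x = y)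
    (hf : ∀ e, e ∈ G.edgeSet → ∀ u ∈ e, u ∈ D.bag (f e)) (hg : ∀ v, v ∈ D.bag (g v)) :
    IsTreeDecomp (GHat G K) (hatDecomp G K D f g) := by
  refine ⟨fun z ↦ ?_, fun a b hab ↦ ?_, fun z hz ↦ ?_⟩
  · by_cases hz : z ∈ (hatDecomp G K D f g).L
    · obtain ⟨x, hx⟩ := hatDecomp_unique hL hg hz
      exact SimpleGraph.induce_connected_of_forall_mem_iff hx
    · obtain ⟨v | e, hv⟩ := z
      · have hset : {x | ⟨Sum.inl v, hv⟩ ∈ (hatDecomp G K D f g).bag x} =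
            {a : D.ι × Bool | a.1 ∈ {x | v ∈ D.bag x}} :=
          Set.ext fun x ↦ ⟨fun h ↦ h.1, fun h ↦ ⟨h, fun h' ↦ absurd h' hz⟩⟩
        rw [hset]
        exact pendantGraph_induce_connected (hconn v)
      · exact absurd trivial hz
  · rcases ((SimpleGraph.fromRel_adj _ _ _).1 hab).2 with h | h
    · exact hatDecomp_exists_bag_of_hatRel hf hg h
    · obtain ⟨x, hb, ha⟩ := hatDecomp_exists_bag_of_hatRel hf hg h
      exact ⟨x, ha, hb⟩
  · obtain ⟨x, hx⟩ := hatDecomp_unique hL hg hz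
    exact ⟨(x, true), (hx _).2 rfl, fun y hy ↦ (hx y).1 hy, hatDecomp_isLeaf x⟩

theorem mem_hatVerts_inr_inr {k : V} {b : Bool} :
    Sum.inr (Sum.inr (k, b)) ∈ hatVerts G K ↔ k ∈ K := Iff.rfl

theorem GHat_exists_terminal_of_triangle {a b c : hatVerts G K} (hab : (GHat G K).Adj a b)
    (hbc : (GHat G K).Adj b c) (hac : (GHat G K).Adj a c) :
    ∃ z : hatVerts G K, (z = a ∨ z = b ∨ z = c) ∧ ∃ k ∈ K, z.val = Sum.inl k := by
  obtain ⟨u | e | ⟨k, i⟩, ha⟩ := a <;> obtain ⟨u' | e' | ⟨k', i'⟩, hb⟩ := b <;>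
    obtain ⟨u'' | e'' | ⟨k'', i''⟩, hc⟩ := c <;>
    simp_all [GHat, hatRel]
  case inr.inr.inr.inr.inr.inr => cases i <;> cases i' <;> cases i'' <;> simp_all
  all_goals grind [mem_hatVerts_inr_inr]

theorem hatDecomp_deltaFree (hK : KFreeCond (↑K : Set V) D) :
    DeltaFreeCond (GHat G K) (hatDecomp G K D f g) := by
  rintro x ⟨a, b, c, ha, hb, hc, hab, hbc, hac⟩
  obtain ⟨⟨_, hz⟩, hzabc, k, hk, rfl⟩ := GHat_exists_terminal_of_triangle hab hbc hac
  have hzL : ⟨Sum.inl k, hz⟩ ∈ (hatDecomp G K D f g).bag x ∩ (hatDecomp G K D f g).L := by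
    rcases hzabc with h | h | h <;> rw [h] <;> assumption
  exact Set.eq_empty_iff_forall_notMem.1 (hK x.1) k ⟨⟨hzL.1.1, hzL.2⟩, hk⟩

theorem hatDecomp_ncard_le [Finite V] (x : D.ι × Bool) :
    ((hatDecomp G K D f g).bag x \ (hatDecomp G K D f g).L).ncard ≤
      (D.bag x.1 \ D.L).ncard := by
  have hsub : (hatDecomp G K D f g).bag x \ (hatDecomp G K D f g).L ⊆
      (fun v ↦ (⟨Sum.inl v, trivial⟩ : hatVerts G K)) '' (D.bag x.1 \ D.L) := by
    rintro ⟨v | e, hv⟩ ⟨hx, hL⟩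
    · exact ⟨v, ⟨hx.1, hL⟩, rfl⟩
    · exact absurd trivial hL
  exact (Set.ncard_le_ncard hsub (Set.toFinite _)).trans (Set.ncard_image_le (Set.toFinite _))

end hatDecomp

/-- For every tree `K`-free-decomposition of `G` of width at most `w`
there is a tree `Δ`-free-decomposition of `Ĝ` of width at most `max{w,1}`; in particular
`tw_Δfree(Ĝ) ≤ max{tw_K(G,K), 1}`. -/
theorem statement5 {V : Type} [Fintype V] [DecidableEq V] (G : SimpleGraph V)
    (K : Finset V) (w : ℕ) (D : PreDecomp V)
    (hD : IsTreeDecomp G D) (hKfree : KFreeCond (↑K : Set V) D) (hw : WidthLE D w) :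
    ∃ D' : PreDecomp (hatVerts G K), IsTreeDecomp (GHat G K) D' ∧
      DeltaFreeCond (GHat G K) D' ∧ WidthLE D' (max w 1) := by
  classical
  obtain ⟨hconn, hedge, hL⟩ := hD
  have hvert : ∀ v : V, ∃ x, v ∈ D.bag x := fun v ↦
    let ⟨x⟩ := (hconn v).nonempty
    ⟨x.1, x.2⟩
  have hsym : ∀ e : Sym2 V, ∃ x, e ∈ G.edgeSet → ∀ u ∈ e, u ∈ D.bag x := by
    intro e
    induction e with
    | h a b =>
      by_cases h : G.Adj a b
      · obtain ⟨x, ha, hb⟩ := hedge a b h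
        exact ⟨x, fun _ u hu ↦ by rcases Sym2.mem_iff.1 hu with rfl | rfl <;> assumption⟩
      · exact ⟨D.root, fun h' ↦ absurd h' h⟩
  choose g hg using hvert
  choose f hf using hsym
  exact ⟨hatDecomp G K D f g, hatDecomp_isTreeDecomp hconn (fun v hv x y hx hy ↦ by
      obtain ⟨z, -, hz, -⟩ := hL v hv
      rw [hz x hx, hz y hy]) hf hg,
    hatDecomp_deltaFree hKfree,
    fun x ↦ (hatDecomp_ncard_le x).trans ((hw x.1).trans (by simp))⟩
end

section
/- Let G be a finite simple graph and K ⊆ V(G), and let Ĝ be the graph obtained from G by subdividing every edge and attaching a triangle to each terminal. Given any tree Δ-free-decomposition of Ĝ of width w, there exists a tree K-free-decomposition of G of width at most w. In particular tw_K(G,K) ≤ tw_Δfree(Ĝ). -/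
theorem SimpleGraph.induce_setOf_or_exists_connected {ι β : Type*} {T : SimpleGraph ι}
    {A : Set ι} {B : β → Set ι} (hA : (T.induce A).Connected)
    (hB : ∀ b, (T.induce (B b)).Connected) (hAB : ∀ b, (A ∩ B b).Nonempty) :
    (T.induce {x | x ∈ A ∨ ∃ b, x ∈ B b}).Connected := by
  obtain ⟨⟨u, hu⟩⟩ := hA.nonempty
  refine SimpleGraph.induce_connected_of_patches u (Or.inl hu) fun {v} hv => ?_
  rcases hv with hv | ⟨b, hv⟩
  · exact ⟨A, fun _ h => Or.inl h, hu, hv, hA.preconnected _ _⟩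
  · refine ⟨A ∪ B b, ?_, Or.inl hu, Or.inr hv,
      (SimpleGraph.induce_union_connected hA.preconnected (hB b).preconnected (hAB b)).preconnected _ _⟩
    rintro x (h | h)
    exacts [Or.inl h, Or.inr ⟨b, h⟩]

namespace GHat

variable {V : Type} {G : SimpleGraph V} {K : Finset V}

/-- A vertex of `G`, seen in `Ĝ`. -/
def vert (G : SimpleGraph V) (K : Finset V) (v : V) : hatVerts G K := ⟨Sum.inl v, trivial⟩

/-- The subdivision vertex `x_e`. -/
def sub (K : Finset V) (e : G.edgeSet) : hatVerts G K := ⟨Sum.inr (Sum.inl e.1), e.2⟩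

/-- The vertices `k'` and `k''`. -/
def pendant (G : SimpleGraph V) (k : K) (b : Bool) : hatVerts G K :=
  ⟨Sum.inr (Sum.inr (k.1, b)), k.2⟩

theorem adj_vert_sub {v : V} {e : G.edgeSet} (h : v ∈ e.1) :
    (GHat G K).Adj (vert G K v) (sub K e) := by
  simp [GHat, vert, sub, hatRel, h, Subtype.ext_iff]

theorem adj_vert_pendant (k : K) (b : Bool) :
    (GHat G K).Adj (vert G K k) (pendant G k b) := by
  simp [GHat, vert, pendant, hatRel, Subtype.ext_iff]

theorem adj_pendant (k : K) : (GHat G K).Adj (pendant G k false) (pendant G k true) := by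
  simp [GHat, pendant, hatRel, Subtype.ext_iff]

/-- An arbitrary choice of an endpoint of each edge. -/
noncomputable def endpoint (e : Sym2 V) : V := e.out.1

theorem endpoint_mem (e : Sym2 V) : endpoint e ∈ e := Sym2.out_fst_mem e

/-- Contract each `x_e` into the chosen endpoint of `e` and each attached triangle into its
terminal. -/
noncomputable def contract (a : hatVerts G K) : V :=
  match a.1 with
  | Sum.inl v => v
  | Sum.inr (Sum.inl e) => endpoint e
  | Sum.inr (Sum.inr (k, _)) => k

/-- The decomposition of `G` induced by one of `Ĝ` after contracting each `x_e` into the chosen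
endpoint of `e`. Only vertices of `L \ K` all of whose contracted `x_e` lie in `L` are kept
in `L`. -/
noncomputable def contractDecomp (D : PreDecomp (hatVerts G K)) : PreDecomp V where
  ι := D.ι
  finite_ι := D.finite_ι
  tree := D.tree
  isTree := D.isTree
  root := D.root
  bag x := {v | vert G K v ∈ D.bag x ∨
    ∃ e : {e : G.edgeSet // endpoint e.1 = v}, sub K e.1 ∈ D.bag x}
  L := {v | vert G K v ∈ D.L ∧ v ∉ K ∧ ∀ e : G.edgeSet, endpoint e.1 = v → sub K e ∈ D.L}

end GHat

/-- The bag containing a vertex of `L` contains all of its neighbours. -/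
theorem IsTreeDecomp.mem_bag_of_adj {W : Type} {H : SimpleGraph W} {D : PreDecomp W}
    (hD : IsTreeDecomp H D) {a b : W} (ha : a ∈ D.L) (hab : H.Adj a b) {x : D.ι}
    (hx : a ∈ D.bag x) : b ∈ D.bag x := by
  obtain ⟨y, -, hy, -⟩ := hD.2.2 a ha
  obtain ⟨z, haz, hbz⟩ := hD.2.1 a b hab
  rwa [hy x hx, ← hy z haz]

namespace GHat

variable {V : Type} {G : SimpleGraph V} {K : Finset V} {D : PreDecomp (hatVerts G K)}

theorem isTreeDecomp_contractDecomp (hD : IsTreeDecomp (GHat G K) D) :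
    IsTreeDecomp G (contractDecomp D) := by
  refine ⟨fun v => ?_, fun u v huv => ?_, fun v hv => ?_⟩
  · refine SimpleGraph.induce_setOf_or_exists_connected (T := D.tree)
      (A := {x | vert G K v ∈ D.bag x})
      (B := fun e : {e : G.edgeSet // endpoint e.1 = v} => {x | sub K e.1 ∈ D.bag x})
      (hD.1 _) (fun e => hD.1 _) fun ⟨e, he⟩ => ?_
    exact hD.2.1 _ _ (adj_vert_sub (he ▸ endpoint_mem e.1))
  · let e : G.edgeSet := ⟨s(u, v), huv⟩
    obtain ⟨x, hux, hex⟩ := hD.2.1 _ _ (adj_vert_sub (K := K) (e := e) (Sym2.mem_mk_left u v))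
    obtain ⟨y, hvy, hey⟩ := hD.2.1 _ _ (adj_vert_sub (K := K) (e := e) (Sym2.mem_mk_right u v))
    rcases Sym2.mem_iff.1 (endpoint_mem s(u, v)) with h | h
    · exact ⟨y, Or.inr ⟨⟨e, h⟩, hey⟩, Or.inl hvy⟩
    · exact ⟨x, Or.inl hux, Or.inr ⟨⟨e, h⟩, hex⟩⟩
  · obtain ⟨hvL, -, he⟩ := hv
    obtain ⟨x, hx, hxu, hleaf⟩ := hD.2.2 _ hvL
    refine ⟨x, Or.inl hx, ?_, hleaf⟩
    rintro y (hy | ⟨⟨e, rfl⟩, hy⟩)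
    · exact hxu y hy
    · exact hxu y (hD.mem_bag_of_adj (he e rfl) (adj_vert_sub (endpoint_mem e.1)).symm hy)

theorem bag_contractDecomp_diff_subset (hD : IsTreeDecomp (GHat G K) D)
    (hΔ : DeltaFreeCond (GHat G K) D) (x : D.ι) :
    (contractDecomp D).bag x \ (contractDecomp D).L ⊆ contract '' (D.bag x \ D.L) := by
  rintro v ⟨hv, hvL⟩
  by_cases hvx : vert G K v ∈ D.bag x
  · by_cases hL : vert G K v ∈ D.L
    · by_cases hK : v ∈ K
      · have hmem (b : Bool) : pendant G ⟨v, hK⟩ b ∈ D.bag x :=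
          hD.mem_bag_of_adj hL (adj_vert_pendant ⟨v, hK⟩ b) hvx
        obtain ⟨b, hb⟩ : ∃ b, pendant G ⟨v, hK⟩ b ∉ D.L := by
          by_contra! h
          exact hΔ x ⟨_, _, _, ⟨hvx, hL⟩, ⟨hmem _, h _⟩, ⟨hmem _, h _⟩,
            adj_vert_pendant ⟨v, hK⟩ false, adj_pendant _, adj_vert_pendant ⟨v, hK⟩ true⟩
        exact ⟨_, ⟨hmem b, hb⟩, rfl⟩
      · obtain ⟨e, rfl, he⟩ : ∃ e : G.edgeSet, endpoint e.1 = v ∧ sub K e ∉ D.L := by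
          by_contra! h
          exact hvL ⟨hL, hK, h⟩
        exact ⟨_, ⟨hD.mem_bag_of_adj hL (adj_vert_sub (endpoint_mem e.1)) hvx, he⟩, rfl⟩
    · exact ⟨_, ⟨hvx, hL⟩, rfl⟩
  · obtain ⟨⟨e, rfl⟩, he⟩ := hv.resolve_left hvx
    exact ⟨_, ⟨he, fun hL => hvx (hD.mem_bag_of_adj hL
      (adj_vert_sub (endpoint_mem e.1)).symm he)⟩, rfl⟩

end GHat

/-- From any tree `Δ`-free-decomposition of `Ĝ` of width at most `w` one
obtains a tree `K`-free-decomposition of `G` of width at most `w`; in particular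
`tw_K(G,K) ≤ tw_Δfree(Ĝ)`. -/
theorem statement6 {V : Type} [Fintype V] [DecidableEq V] (G : SimpleGraph V)
    (K : Finset V) (w : ℕ) (D' : PreDecomp (hatVerts G K))
    (hD' : IsTreeDecomp (GHat G K) D') (hΔ : DeltaFreeCond (GHat G K) D')
    (hw : WidthLE D' w) :
    ∃ D : PreDecomp V, IsTreeDecomp G D ∧ KFreeCond (↑K : Set V) D ∧ WidthLE D w := by
  refine ⟨GHat.contractDecomp D', GHat.isTreeDecomp_contractDecomp hD', fun x => ?_, fun x => ?_⟩
  · exact Set.eq_empty_of_forall_notMem fun v ⟨⟨_, hvL⟩, hvK⟩ => hvL.2.1 hvK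
  · have hfin := Set.toFinite (D'.bag x \ D'.L)
    exact (Set.ncard_le_ncard (GHat.bag_contractDecomp_diff_subset hD' hΔ x)
      (hfin.image _)).trans ((Set.ncard_image_le hfin).trans (hw x))
end

section
/- Let G be a finite simple graph with edge weights cost : E(G) → ℕ, and let Y, Z ⊆ V(G) be disjoint vertex sets with Z ≠ ∅. Let ℱ(Z) be the set of all subgraphs of the induced subgraph G[Z ∪ Y]. Then there exists a set ℛ(Z) ⊆ ℱ(Z) with |ℛ(Z)| ≤ 2^{|Z|−1} such that ℛ(Z) represents ℱ(Z) on Z. -/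
/-- The cost of a subgraph: the sum of the weights of its edges. -/
noncomputable def subCost {V : Type} [Fintype V] {G : SimpleGraph V}
    (cost : Sym2 V → ℕ) (H : G.Subgraph) : ℕ :=
  ∑ e ∈ H.edgeSet.toFinite.toFinset, cost e

/-- The partition `π_F(X)` of `X` induced by a subgraph `F`, encoded as an equivalence
relation (= setoid) on `X`: vertices of `X` outside `V(F)` are singleton blocks, and two
vertices of `X ∩ V(F)` lie in the same block iff they lie in the same connected component
of `F`. -/
def piF {V : Type} {G : SimpleGraph V} (F : G.Subgraph) (X : Set V) : Setoid X where
  r u v := u = v ∨ ((u : V) ∈ F.verts ∧ (v : V) ∈ F.verts ∧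
    F.spanningCoe.Reachable (u : V) (v : V))
  iseqv := by
    constructor
    · intro u; exact Or.inl rfl
    · rintro u v (rfl | ⟨hu, hv, h⟩)
      · exact Or.inl rfl
      · exact Or.inr ⟨hv, hu, h.symm⟩
    · rintro u v w (rfl | ⟨hu, hv, h⟩) h'
      · exact h'
      · rcases h' with (rfl | ⟨hv', hw, h'⟩)
        · exact Or.inr ⟨hu, hv, h⟩
        · exact Or.inr ⟨hu, hw, h.trans h'⟩

/-- A family `R` of subgraphs *represents* a family `B` on `Z` if for every partition `Q`
of `Z` (encoded as a setoid), the minimum cost of a member `F` with `π_F(Z) ⊔ Q = {Z}`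
(the join being taken in the partition lattice, and `{Z}` being the one-block partition,
i.e. `⊤`) is the same over `B` as over `R`; minima are taken in `ℕ∪{∞}` with `min ∅ = ∞`. -/
def RepresentsOn {V : Type} [Fintype V] {G : SimpleGraph V} (cost : Sym2 V → ℕ)
    (Z : Set V) (B R : Set G.Subgraph) : Prop :=
  ∀ Q : Setoid Z,
    sInf {w : ℕ∞ | ∃ F ∈ B, piF F Z ⊔ Q = ⊤ ∧ w = (subCost cost F : ℕ∞)} =
    sInf {w : ℕ∞ | ∃ F ∈ R, piF F Z ⊔ Q = ⊤ ∧ w = (subCost cost F : ℕ∞)}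

open Classical in
/-- The indicator vector over `ZMod 2` of the cuts `A` (vertex sets avoiding `z`) that split
no block of the partition `P`. -/
noncomputable def cutVector {U : Type*} [Fintype U] (z : U) (P : Setoid U) :
    (Finset.univ.erase z).powerset → ZMod 2 :=
  fun A => if P ≤ Setoid.ker (fun u => u ∈ A.1) then 1 else 0

open Classical in
/-- The number of cuts splitting no block of `P` and no block of `Q` is odd iff `P ⊔ Q = ⊤`. -/
theorem cutVector_dotProduct {U : Type*} [Fintype U] (z : U) (P Q : Setoid U) :
    cutVector z P ⬝ᵥ cutVector z Q = if P ⊔ Q = ⊤ then 1 else 0 := by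
  have hsum : cutVector z P ⬝ᵥ cutVector z Q = ∑ A ∈ (Finset.univ.erase z).powerset,
      if P ⊔ Q ≤ Setoid.ker (fun u => u ∈ A) then (1 : ZMod 2) else 0 := by
    rw [← Finset.sum_coe_sort]
    refine Finset.sum_congr rfl fun A _ => ?_
    simp only [cutVector, sup_le_iff, ite_and, mul_ite, mul_one, mul_zero]
    split_ifs <;> rfl
  rw [hsum]
  generalize P ⊔ Q = S
  split_ifs with h
  · subst h
    rw [Finset.sum_eq_single ∅]
    · exact if_pos fun u v _ => by simp
    · intro A hA hne
      refine if_neg fun hle => hne ?_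
      ext u
      have hzA : z ∉ A := fun hz => by simpa using Finset.mem_powerset.1 hA hz
      have huz : (u ∈ A) = (z ∈ A) := hle (x := u) (y := z) trivial
      simp [huz, hzA]
    · intro hne
      simp at hne
  · obtain ⟨x, hx⟩ : ∃ x, ¬ S x z := by
      by_contra! hall
      exact h (Setoid.ext fun u v => ⟨fun _ => trivial, fun _ =>
        S.trans (hall u) (S.symm (hall v))⟩)
    set D : Finset U := {y | S x y} with hD
    have hmem (A : Finset U) (u : U) : u ∈ symmDiff A D ↔ ¬ (u ∈ A ↔ S x u) := by
      simp [Finset.mem_symmDiff, hD]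
      tauto
    have hclosed (A : Finset U) (hA : S ≤ Setoid.ker (fun u => u ∈ A)) :
        S ≤ Setoid.ker (fun u => u ∈ symmDiff A D) := by
      intro u v huv
      have h₁ : (u ∈ A) = (v ∈ A) := hA huv
      have h₂ : S x u ↔ S x v := ⟨fun k => S.trans k huv, fun k => S.trans k (S.symm huv)⟩
      change (u ∈ symmDiff A D) = (v ∈ symmDiff A D)
      rw [eq_iff_iff, hmem, hmem, h₁, h₂]
    refine Finset.sum_involution (fun A _ => symmDiff A D) ?_ ?_ ?_ ?_
    · intro A _
      have hiff : S ≤ Setoid.ker (fun u => u ∈ symmDiff A D) ↔ S ≤ Setoid.ker (fun u => u ∈ A) :=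
        ⟨fun k => by simpa [symmDiff_symmDiff_cancel_right] using hclosed _ k, hclosed A⟩
      simp only [hiff]
      split_ifs <;> decide
    · intro A _ _ heq
      have hxx := hmem A x
      rw [heq] at hxx
      have := S.refl x
      tauto
    · intro A hA
      refine Finset.mem_powerset.2 fun u hu => Finset.mem_erase.2 ⟨?_, Finset.mem_univ u⟩
      rintro rfl
      have : u ∉ A := fun hz => by simpa using Finset.mem_powerset.1 hA hz
      exact (hmem A u).1 hu ⟨fun k => absurd k this, fun k => absurd k hx⟩
    · intro A _
      exact symmDiff_symmDiff_cancel_right D A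

/-- A minimum weight basis: every vector of weight at most `N` is spanned by basis vectors of no
larger weight. -/
theorem exists_linearIndepOn_minWeight {K ι W : Type*} [DivisionRing K] [AddCommGroup W]
    [Module K W] (f : ι → W) (w : ι → ℕ) (B : Set ι) (N : ℕ) :
    ∃ R ⊆ {i ∈ B | w i < N}, LinearIndepOn K f R ∧
      ∀ i ∈ B, w i < N → f i ∈ Submodule.span K (f '' {r ∈ R | w r ≤ w i}) := by
  induction N with
  | zero => exact ⟨∅, by simp, linearIndepOn_empty K f, by simp⟩
  | succ N ih =>
    obtain ⟨R, hRB, hR, hspan⟩ := ih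
    obtain ⟨R', hR'B, hRR', hspan', hR'⟩ := exists_linearIndepOn_extension
      (t := {i ∈ B | w i < N + 1}) hR (fun i hi => ⟨(hRB hi).1, (hRB hi).2.trans N.lt_succ_self⟩)
    refine ⟨R', hR'B, hR', fun i hi hiN => ?_⟩
    rcases (Nat.lt_succ_iff_lt_or_eq.1 hiN) with hlt | heq
    · exact Submodule.span_mono (Set.image_mono
        (Set.inter_subset_inter_left {r | w r ≤ w i} hRR')) (hspan i hi hlt)
    · have hset : {r ∈ R' | w r ≤ w i} = R' :=
        Set.sep_eq_self_iff_mem_true.2 fun r hr => heq ▸ Nat.lt_succ_iff.1 (hR'B hr).2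
      rw [hset]
      exact hspan' (Set.mem_image_of_mem f ⟨hi, hiN⟩)

/-- If the cut vector of `P` is spanned by those of a family of partitions, then any `Q` joining
with `P` to `⊤` also joins with some member of the family to `⊤`. -/
theorem exists_sup_eq_top_of_mem_span {U ι : Type*} [Fintype U] (z : U) (p : ι → Setoid U)
    (R : Set ι) {P Q : Setoid U} (hPQ : P ⊔ Q = ⊤)
    (hP : cutVector z P ∈ Submodule.span (ZMod 2) ((fun i => cutVector z (p i)) '' R)) :
    ∃ r ∈ R, p r ⊔ Q = ⊤ := by
  by_contra! hR
  have hzero : ∀ v ∈ Submodule.span (ZMod 2) ((fun i => cutVector z (p i)) '' R),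
      v ⬝ᵥ cutVector z Q = 0 := by
    intro v hv
    induction hv using Submodule.span_induction with
    | mem v hv =>
      obtain ⟨r, hr, rfl⟩ := hv
      simp [cutVector_dotProduct, hR r hr]
    | zero => simp
    | add v w _ _ hv hw => rw [add_dotProduct, hv, hw, add_zero]
    | smul a v _ hv => rw [smul_dotProduct, hv, smul_zero]
  have := hzero _ hP
  simp [cutVector_dotProduct, hPQ] at this

/-- Linearly independent cut vectors over `U` number at most `2 ^ (|U| - 1)`. -/
theorem ncard_le_of_linearIndepOn_cutVector {U ι : Type*} [Fintype U] {z : U}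
    {p : ι → Setoid U} {R : Set ι} (hR : LinearIndepOn (ZMod 2) (fun i => cutVector z (p i)) R) :
    R.Finite ∧ R.ncard ≤ 2 ^ (Fintype.card U - 1) := by
  classical
  have hfin : R.Finite := Set.finite_coe_iff.1 (LinearIndependent.finite hR.linearIndependent)
  refine ⟨hfin, ?_⟩
  have := hfin.fintype
  have hle := LinearIndependent.fintype_card_le_finrank hR.linearIndependent
  rw [← Nat.card_coe_set_eq, Nat.card_eq_fintype_card]
  rwa [Module.finrank_fintype_fun_eq_card, Fintype.card_coe, Finset.card_powerset,
    Finset.card_erase_of_mem (Finset.mem_univ _), Finset.card_univ] at hle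

/-- For disjoint vertex sets `Y, Z ⊆ V(G)` with `Z ≠ ∅`, letting `ℱ(Z)`
be the family of all subgraphs of the induced subgraph `G[Z ∪ Y]`, there is
`ℛ(Z) ⊆ ℱ(Z)` with `|ℛ(Z)| ≤ 2^{|Z|−1}` representing `ℱ(Z)` on `Z`. -/
theorem statement7 {V : Type} [Fintype V] [DecidableEq V] (G : SimpleGraph V)
    (cost : Sym2 V → ℕ) (Y Z : Finset V) (hdisj : Disjoint Y Z) (hZ : Z.Nonempty) :
    ∃ R ⊆ {F : G.Subgraph | F ≤ (⊤ : G.Subgraph).induce (↑Z ∪ ↑Y)},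
      R.Finite ∧ R.ncard ≤ 2 ^ (Z.card - 1) ∧
      RepresentsOn cost (↑Z : Set V)
        {F : G.Subgraph | F ≤ (⊤ : G.Subgraph).induce (↑Z ∪ ↑Y)} R := by
  obtain ⟨z, hz⟩ := hZ
  set B : Set G.Subgraph := {F | F ≤ (⊤ : G.Subgraph).induce (↑Z ∪ ↑Y)}
  let z' : (↑Z : Set V) := ⟨z, hz⟩
  obtain ⟨R, hRB, hR, hspan⟩ := exists_linearIndepOn_minWeight (K := ZMod 2)
    (fun F : G.Subgraph => cutVector z' (piF F ↑Z)) (subCost cost) B (∑ e, cost e + 1)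
  have hlt (F : G.Subgraph) : subCost cost F < ∑ e, cost e + 1 :=
    Nat.lt_succ_of_le (Finset.sum_le_sum_of_subset (Finset.subset_univ _))
  have hRsub : R ⊆ B := fun F hF => (hRB hF).1
  obtain ⟨hfin, hcard⟩ := ncard_le_of_linearIndepOn_cutVector hR
  rw [Fintype.card_eq_nat_card, Nat.card_coe_set_eq, Set.ncard_coe_finset] at hcard
  refine ⟨R, hRsub, hfin, hcard, fun Q => le_antisymm ?_ ?_⟩
  · refine sInf_le_sInf ?_
    rintro w ⟨F, hF, h⟩
    exact ⟨F, hRsub hF, h⟩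
  · refine le_sInf ?_
    rintro w ⟨F, hF, hFQ, rfl⟩
    obtain ⟨r, hr, hrQ⟩ :=
      exists_sup_eq_top_of_mem_span z' (fun F : G.Subgraph => piF F ↑Z) _ hFQ (hspan F hF (hlt F))
    exact le_trans (sInf_le (Set.mem_ofPred.2 ⟨r, hr.1, hrQ, rfl⟩)) (Nat.cast_le.2 hr.2)
end

section
/- Let G be a finite simple graph with edge weights cost : E(G) → ℕ and terminal set K ⊆ V(G). Let X ⊆ V(G) be such that Y := V(G)∖X contains no vertex of K, let Z ⊆ X with K ⊆ Z, and let P ∈ Π(Z). Then min{cost(F) : F a subgraph of G with V(F) ∩ X = Z, π_F(Z) = P, the number of connected components of F equal to |P|, and K ⊆ V(F)} = min{cost(F) : F a subgraph of the induced subgraph G[Z ∪ Y] with π_F(Z) = P}, where both minima are taken in ℕ∪{∞} with min ∅ = ∞. -/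
open SimpleGraph in
theorem piF_apply_iff_reachable {V : Type} {G : SimpleGraph V} (F : G.Subgraph) {X : Set V}
    (u v : X) : piF F X u v ↔ F.spanningCoe.Reachable (u : V) (v : V) := by
  constructor
  · rintro (rfl | ⟨-, -, h⟩)
    · exact Reachable.refl _
    · exact h
  · intro h
    by_cases huv : u = v
    · exact Or.inl huv
    · have hne : (u : V) ≠ v := fun h' => huv (Subtype.ext h')
      refine Or.inr ⟨?_, ?_, h⟩
      · rw [reachable_iff_reflTransGen] at h
        rcases h.cases_head with h | ⟨w, hw, -⟩
        · exact absurd h hne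
        · exact F.edge_vert hw
      · rw [reachable_iff_reflTransGen] at h
        rcases h.cases_tail with h | ⟨w, -, hw⟩
        · exact absurd h.symm hne
        · exact F.edge_vert (Subgraph.Adj.symm hw)

/-- The subgraph formed by the vertices of `Z` and the connected components of `F`
meeting `Z`. -/
def componentsMeeting {V : Type} {G : SimpleGraph V} (F : G.Subgraph) (Z : Set V) :
    G.Subgraph where
  verts := {v | ∃ z ∈ Z, F.spanningCoe.Reachable z v}
  Adj u v := F.Adj u v ∧ ∃ z ∈ Z, F.spanningCoe.Reachable z u
  adj_sub h := h.1.adj_sub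
  edge_vert h := h.2
  symm := ⟨fun _ _ ⟨h, z, hz, hr⟩ =>
    ⟨h.symm, z, hz, hr.trans (SimpleGraph.Adj.reachable (G := F.spanningCoe) h)⟩⟩

namespace componentsMeeting

open SimpleGraph

variable {V : Type} {G : SimpleGraph V} (F : G.Subgraph) (Z : Set V)

theorem subset_verts : Z ⊆ (componentsMeeting F Z).verts :=
  fun z hz => ⟨z, hz, Reachable.refl z⟩

theorem verts_subset : (componentsMeeting F Z).verts ⊆ Z ∪ F.verts := by
  rintro v ⟨z, hz, h⟩
  rw [reachable_iff_reflTransGen] at h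
  rcases h.cases_tail with rfl | ⟨w, -, hw⟩
  · exact Or.inl hz
  · exact Or.inr (F.edge_vert (Subgraph.Adj.symm hw))

theorem spanningCoe_le : (componentsMeeting F Z).spanningCoe ≤ F.spanningCoe :=
  fun _ _ h => h.1

theorem coe_reachable_iff (u v : (componentsMeeting F Z).verts) :
    (componentsMeeting F Z).coe.Reachable u v ↔ F.spanningCoe.Reachable (u : V) (v : V) := by
  constructor
  · intro h
    exact h.map (⟨Subtype.val, fun h => h.1⟩ : (componentsMeeting F Z).coe →g F.spanningCoe)
  · obtain ⟨u, hu⟩ := u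
    obtain ⟨v, hv⟩ := v
    intro h
    dsimp only at h
    rw [reachable_iff_reflTransGen] at h
    induction h with
    | refl => exact Reachable.refl _
    | @tail b c _ hbc ih =>
      have hcb : F.Adj c b := Subgraph.Adj.symm hbc
      have hb : b ∈ (componentsMeeting F Z).verts := by
        obtain ⟨z, hz, hr⟩ := hv
        exact ⟨z, hz, hr.trans (Adj.reachable (G := F.spanningCoe) hcb)⟩
      exact (ih hb).trans (Adj.reachable (G := (componentsMeeting F Z).coe)
        (u := ⟨b, hb⟩) (v := ⟨c, hv⟩) ⟨hbc, hb⟩)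

theorem piF_eq : piF (componentsMeeting F Z) Z = piF F Z := by
  ext u v
  rw [piF_apply_iff_reachable, piF_apply_iff_reachable]
  refine ⟨fun h => h.mono (spanningCoe_le F Z), fun h => ?_⟩
  have h' := (coe_reachable_iff F Z ⟨u, subset_verts F Z u.2⟩ ⟨v, subset_verts F Z v.2⟩).2 h
  exact h'.map (⟨Subtype.val, id⟩ :
    (componentsMeeting F Z).coe →g (componentsMeeting F Z).spanningCoe)

theorem card_connectedComponent :
    Nat.card (componentsMeeting F Z).coe.ConnectedComponent =
      Nat.card (Quotient (piF F Z)) := by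
  let f : Z → (componentsMeeting F Z).coe.ConnectedComponent := fun z =>
    (componentsMeeting F Z).coe.connectedComponentMk ⟨z, subset_verts F Z z.2⟩
  have hf : Function.Surjective f := by
    intro c
    induction c using ConnectedComponent.ind with
    | h v =>
      obtain ⟨v, z, hz, hr⟩ := v
      exact ⟨⟨z, hz⟩, ConnectedComponent.eq.2 ((coe_reachable_iff F Z _ _).2 hr)⟩
  have hker : Setoid.ker f = piF F Z := by
    ext u v
    rw [piF_apply_iff_reachable, Setoid.ker_def, ConnectedComponent.eq, coe_reachable_iff]
  rw [← hker]
  exact (Nat.card_congr (Setoid.quotientKerEquivOfSurjective f hf)).symm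

theorem subCost_le [Fintype V] (cost : Sym2 V → ℕ) :
    subCost cost (componentsMeeting F Z) ≤ subCost cost F := by
  refine Finset.sum_le_sum_of_subset (Set.Finite.toFinset_subset_toFinset.2 fun e => ?_)
  induction e using Sym2.ind with
  | _ u v => exact fun h => h.1

end componentsMeeting

/-- Let `K` be the terminal set, `X ⊆ V(G)` with `Y := V(G)∖X`
terminal-free, `Z ⊆ X` with `K ⊆ Z`, and `P` a partition of `Z`.  Then the minimum cost of
a subgraph `F` of `G` with `V(F) ∩ X = Z`, `π_F(Z) = P`, exactly `|P|` connected
components, and `K ⊆ V(F)`, equals the minimum cost of a subgraph `F` of the induced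
subgraph `G[Z ∪ Y]` with `π_F(Z) = P`. -/
theorem statement12 {V : Type} [Fintype V] [DecidableEq V] (G : SimpleGraph V)
    (cost : Sym2 V → ℕ) (K : Finset V) (X : Set V)
    (hY : (↑K : Set V) ∩ Xᶜ = ∅)
    (Z : Finset V) (hZX : (↑Z : Set V) ⊆ X) (hKZ : K ⊆ Z)
    (P : Setoid (↑Z : Set V)) :
    sInf {w : ℕ∞ | ∃ F : G.Subgraph, F.verts ∩ X = ↑Z ∧ piF F (↑Z : Set V) = P ∧
        Nat.card F.coe.ConnectedComponent = Nat.card (Quotient P) ∧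
        (↑K : Set V) ⊆ F.verts ∧ w = (subCost cost F : ℕ∞)} =
    sInf {w : ℕ∞ | ∃ F : G.Subgraph, F ≤ (⊤ : G.Subgraph).induce ((↑Z : Set V) ∪ Xᶜ) ∧
        piF F (↑Z : Set V) = P ∧ w = (subCost cost F : ℕ∞)} := by
  apply le_antisymm
  · refine le_sInf ?_
    rintro _ ⟨F, hF, hP, rfl⟩
    have hsub := componentsMeeting.subset_verts F (Z : Set V)
    refine sInf_le_of_le ⟨componentsMeeting F Z, ?_, ?_, ?_, ?_, rfl⟩
      (Nat.cast_le.2 (componentsMeeting.subCost_le F Z cost))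
    · refine Set.Subset.antisymm ?_ fun z hz => ⟨hsub hz, hZX hz⟩
      rintro v ⟨hv, hvX⟩
      rcases componentsMeeting.verts_subset F Z hv with h | h
      · exact h
      · exact (hF.1 h).resolve_right fun h' => h' hvX
    · rw [componentsMeeting.piF_eq, hP]
    · rw [componentsMeeting.card_connectedComponent, hP]
    · exact (Finset.coe_subset.2 hKZ).trans hsub
  · refine sInf_le_sInf ?_
    rintro w ⟨F, hFX, hP, -, -, rfl⟩
    have hv : F.verts ⊆ (Z : Set V) ∪ Xᶜ := fun v hv => by
      by_cases hX : v ∈ X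
      · exact Or.inl (hFX ▸ ⟨hv, hX⟩)
      · exact Or.inr hX
    exact ⟨F, ⟨hv, fun u v h => ⟨hv (F.edge_vert h), hv (F.edge_vert h.symm), h.adj_sub⟩⟩,
      hP, rfl⟩
end
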